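/- (One-dimensional L¹ regularity) Let ν : Σ → ℝ be additive with finite L¹ norm, let 𝒜₀ be a partition, let E, D be positive, and let B̂ be a function assigning to each partition 𝒜 a refinement B̂(𝒜) ⪰ 𝒜. Then there exists a partition ℬ* ⪰ 𝒜₀ such that for every partition ℬ with ℬ* ⪯ ℬ ⪯ B̂(ℬ*), the set 𝔇_{E,ℬ*,ν}(ℬ) = {σ ∈ ℬ : |δ_ν(σ) − δ_ν(σ_{ℬ*})| ≥ 1/E} has measure μ(𝔇_{E,ℬ*,ν}(ℬ)) < 1/D. -/

import Mathlib

open scoped Classical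

/-- An additive function on a Boolean algebra. -/
def IsAdditive {α : Type*} [BooleanAlgebra α] (ν : α → ℝ) : Prop :=
  ν ⊥ = 0 ∧ ∀ σ τ : α, ν (σ ⊔ τ) = ν σ + ν τ - ν (σ ⊓ τ)

/-- A partition: a finite set of pairwise disjoint elements. -/
def IsPartition {α : Type*} [BooleanAlgebra α] (A : Finset α) : Prop :=
  ∀ σ ∈ A, ∀ τ ∈ A, σ ≠ τ → σ ⊓ τ = ⊥

/-- `Refines A B` means `B` refines `A`. -/
def Refines {α : Type*} [BooleanAlgebra α] (A B : Finset α) : Prop :=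
  B.sup id = A.sup id ∧ ∀ σ ∈ B, ∃ τ ∈ A, σ ≤ τ

theorem l1r_sum {α : Type*} [BooleanAlgebra α] {ν : α → ℝ} (h : IsAdditive ν) (A : Finset α)
    (hA : IsPartition A) : ν (A.sup id) = ∑ σ ∈ A, ν σ := by
  induction A using Finset.induction_on with
  | empty => simpa using h.1
  | insert a s ha ih =>
    have hs : IsPartition s := fun σ hσ τ hτ =>
      hA σ (Finset.mem_insert_of_mem hσ) τ (Finset.mem_insert_of_mem hτ)
    rw [Finset.sup_insert, Finset.sum_insert ha, h.2, ih hs]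
    have : a ⊓ s.sup id = ⊥ := by
      rw [← disjoint_iff, Finset.disjoint_sup_right]
      intro i hi
      rw [disjoint_iff]
      exact hA a (Finset.mem_insert_self _ _) i (Finset.mem_insert_of_mem hi)
        (fun e => ha (e ▸ hi))
    simp only [id] at this ⊢
    rw [this, h.1]; ring

theorem l1r_cell {α : Type*} [BooleanAlgebra α] {ν : α → ℝ} (h : IsAdditive ν) (A B : Finset α)
    (hA : IsPartition A) (hB : IsPartition B) (hAB : Refines A B) (τ : α) (hτ : τ ∈ A) :
    ν τ = ∑ σ ∈ B.filter (fun σ => σ ≤ τ), ν σ := by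
  rw [← l1r_sum h]
  · congr 1
    apply le_antisymm
    · have h1 : τ ≤ B.sup id := by
        rw [hAB.1]; exact Finset.le_sup (f := id) hτ
      refine (le_inf le_rfl h1).trans ?_
      rw [Finset.sup_inf_distrib_left]
      apply Finset.sup_le
      intro σ hσ
      obtain ⟨τ', hτ', hle⟩ := hAB.2 σ hσ
      by_cases e : τ = τ'
      · subst e
        exact inf_le_right.trans
          (Finset.le_sup (f := id) (Finset.mem_filter.2 ⟨hσ, by simpa using hle⟩))
      · have := hA τ hτ τ' hτ' e
        calc τ ⊓ id σ ≤ τ ⊓ τ' := inf_le_inf_left _ hle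
          _ = ⊥ := this
          _ ≤ _ := bot_le
    · apply Finset.sup_le
      intro σ hσ
      exact (Finset.mem_filter.1 hσ).2
  · intro σ hσ τ hτ
    exact hB σ (Finset.mem_filter.1 hσ).1 τ (Finset.mem_filter.1 hτ).1

theorem l1r_fib {α : Type*} [BooleanAlgebra α] (f : α → ℝ) (h : f ⊥ = 0) (A B : Finset α)
    (hA : IsPartition A) (hAB : Refines A B) :
    ∑ τ ∈ A, ∑ σ ∈ B.filter (fun σ => σ ≤ τ), f σ = ∑ σ ∈ B, f σ := by
  simp_rw [Finset.sum_filter]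
  rw [Finset.sum_comm]
  apply Finset.sum_congr rfl
  intro σ hσ
  by_cases e : σ = ⊥
  · subst e; simp [h]
  obtain ⟨τ, hτ, hle⟩ := hAB.2 σ hσ
  rw [Finset.sum_eq_single τ]
  · simp [hle]
  · intro τ' hτ' hne
    rw [if_neg]
    intro h2
    exact e (le_bot_iff.1 ((le_inf h2 hle).trans (hA τ' hτ' τ hτ hne).le))
  · intro h2; exact absurd hτ h2

theorem l1r_pt (x y E K : ℝ) (hE : 0 < E) (hx : |x| ≤ K) (hy : |y| ≤ K)
    (h : 1 / E ≤ |x - y|) :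
    1 ≤ 2 * (1 + K^2)^2 * E^2 * (√(1 + x^2) - (1 + x*y) / √(1 + y^2)) := by
  have hx2 : x^2 ≤ K^2 := sq_le_sq' (by linarith [neg_abs_le x]) (by linarith [le_abs_self x])
  have hy2 : y^2 ≤ K^2 := sq_le_sq' (by linarith [neg_abs_le y]) (by linarith [le_abs_self y])
  have hd : 1 ≤ (x-y)^2 * E^2 := by
    rw [div_le_iff₀ hE] at h
    have : 1 ≤ (|x-y| * E)^2 := one_le_pow₀ h
    rwa [mul_pow, sq_abs] at this
  have ha0 : 0 < √(1 + x^2) := Real.sqrt_pos.2 (by positivity)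
  have hb0 : 0 < √(1 + y^2) := Real.sqrt_pos.2 (by positivity)
  have ha : √(1 + x^2)^2 = 1 + x^2 := Real.sq_sqrt (by positivity)
  have hb : √(1 + y^2)^2 = 1 + y^2 := Real.sq_sqrt (by positivity)
  set a := √(1 + x^2)
  set b := √(1 + y^2)
  set L := 1 + K^2 with hL
  have hL1 : 1 ≤ L := by nlinarith [sq_nonneg K]
  have hbL : b ≤ L := by nlinarith
  have habL : a * b ≤ L := by nlinarith [sq_nonneg (a-b)]
  have hid : (a*b - (1+x*y)) * (a*b + (1+x*y)) = (x-y)^2 := by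
    have : (a*b - (1+x*y)) * (a*b + (1+x*y)) = a^2*b^2 - (1+x*y)^2 := by ring
    rw [this, ha, hb]; ring
  have hab : 0 < a * b := mul_pos ha0 hb0
  have habs : |1 + x*y| ≤ a*b := by
    apply abs_le_of_sq_le_sq _ hab.le
    nlinarith [sq_nonneg (x-y)]
  have h1 := (abs_le.1 habs).1
  have h2 := (abs_le.1 habs).2
  have h3 : 1 ≤ (a*b - (1+x*y)) * (2 * L) * E^2 := by
    refine hd.trans (mul_le_mul_of_nonneg_right ?_ (by positivity))
    rw [← hid]
    exact mul_le_mul_of_nonneg_left (by linarith) (by linarith)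
  have h4 : a - (1+x*y)/b = (a*b - (1+x*y)) / b := by field_simp
  rw [h4]
  have h5 : (a*b - (1+x*y)) ≤ L * ((a*b - (1+x*y)) / b) := by
    rw [← mul_div_assoc, le_div_iff₀ hb0, mul_comm]
    exact mul_le_mul_of_nonneg_right hbL (by linarith)
  calc 1 ≤ (a*b - (1+x*y)) * (2 * L) * E^2 := h3
    _ ≤ (L * ((a*b - (1+x*y)) / b)) * (2 * L) * E^2 := by gcongr
    _ = _ := by ring

theorem l1r_gain (m n M P : ℝ) :
    0 ≤ √(m^2 + n^2) - (m*M + n*P) / √(M^2 + P^2) := by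
  rw [sub_nonneg]
  apply div_le_of_le_mul₀ (Real.sqrt_nonneg _) (Real.sqrt_nonneg _)
  rw [← Real.sqrt_mul (by positivity)]
  apply Real.le_sqrt_of_sq_le
  nlinarith [sq_nonneg (m*P - n*M)]

theorem l1r_bad (m n M P E K : ℝ) (hE : 0 < E) (hK : 0 < K) (hm : 0 ≤ m) (hmM : m ≤ M)
    (h : 1 / E ≤ |n / m - P / M|) :
    m ≤ |n| / K + m * (|P| / M / K) + 2 * (1 + K^2)^2 * E^2 *
      (√(m^2 + n^2) - (m*M + n*P) / √(M^2 + P^2)) := by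
  have hg := l1r_gain m n M P
  have hM : 0 ≤ M := hm.trans hmM
  have hg' : 0 ≤ 2 * (1 + K^2)^2 * E^2 *
      (√(m^2 + n^2) - (m*M + n*P) / √(M^2 + P^2)) := by positivity
  have t1 : 0 ≤ |n| / K := by positivity
  have t2 : 0 ≤ m * (|P| / M / K) := by positivity
  rcases hm.eq_or_lt with h0 | hm0
  · linarith
  have hM0 : 0 < M := hm0.trans_le hmM
  by_cases hx : |n / m| ≤ K
  · by_cases hy : |P / M| ≤ K
    · have := l1r_pt _ _ E K hE hx hy h
      have e1 : √(m^2 + n^2) = m * √(1 + (n/m)^2) := by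
        rw [← Real.sqrt_sq hm, ← Real.sqrt_mul (by positivity), Real.sqrt_sq hm]
        congr 1; field_simp
      have e2 : √(M^2 + P^2) = M * √(1 + (P/M)^2) := by
        rw [← Real.sqrt_sq hM, ← Real.sqrt_mul (by positivity), Real.sqrt_sq hM]
        congr 1; field_simp
      have hb0 : 0 < √(1 + (P/M)^2) := Real.sqrt_pos.2 (by positivity)
      have e3 : √(m^2 + n^2) - (m*M + n*P) / √(M^2 + P^2) =
          m * (√(1 + (n/m)^2) - (1 + (n/m)*(P/M)) / √(1 + (P/M)^2)) := by
        rw [e1, e2, mul_sub]; congr 1; field_simp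
      rw [e3]
      have := mul_le_mul_of_nonneg_left this hm
      linarith
    · push Not at hy
      rw [abs_div, abs_of_pos hM0] at hy
      have : 1 ≤ |P| / M / K := by rw [le_div_iff₀ hK]; linarith
      have := mul_le_mul_of_nonneg_left this hm
      linarith
  · push Not at hx
    rw [abs_div, abs_of_pos hm0, lt_div_iff₀ hm0] at hx
    have : m ≤ |n| / K := by rw [le_div_iff₀ hK]; linarith
    linarith

theorem l1r_mono {α : Type*} [BooleanAlgebra α] {μ : α → ℝ} (h : IsAdditive μ)
    (h0 : ∀ σ, 0 ≤ μ σ) {σ τ : α} (hle : σ ≤ τ) : μ σ ≤ μ τ := by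
  have := h.2 σ (τ \ σ)
  rw [sup_sdiff_cancel_right hle, inf_sdiff_self_right, h.1] at this
  linarith [h0 (τ \ σ)]

theorem l1r_step {α : Type*} [BooleanAlgebra α]
    (μ ν : α → ℝ) (hμadd : IsAdditive μ) (hνadd : IsAdditive ν)
    (hμ0 : ∀ σ, 0 ≤ μ σ) (E K : ℝ) (hE : 0 < E) (hK : 0 < K)
    (A B : Finset α) (hA : IsPartition A) (hB : IsPartition B) (hAB : Refines A B) :
    (∑ σ ∈ B.filter (fun σ =>
          ∃ τ ∈ A, σ ≤ τ ∧ 1 / E ≤ |ν σ / μ σ - ν τ / μ τ|), μ σ) ≤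
      (∑ σ ∈ B, |ν σ|) / K + (∑ τ ∈ A, |ν τ|) / K + 2 * (1 + K^2)^2 * E^2 *
        (∑ σ ∈ B, √(μ σ^2 + ν σ^2) - ∑ τ ∈ A, √(μ τ^2 + ν τ^2)) := by
  set C := 2 * (1 + K^2)^2 * E^2 with hC
  have key : ∀ τ ∈ A, ∑ σ ∈ B.filter (fun σ => σ ≤ τ),
      (if 1 / E ≤ |ν σ / μ σ - ν τ / μ τ| then μ σ else 0) ≤
      (∑ σ ∈ B.filter (fun σ => σ ≤ τ), |ν σ|) / K + |ν τ| / K + C *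
        (∑ σ ∈ B.filter (fun σ => σ ≤ τ), √(μ σ^2 + ν σ^2) - √(μ τ^2 + ν τ^2)) := by
    intro τ hτ
    have hm := l1r_cell hμadd A B hA hB hAB τ hτ
    have hn := l1r_cell hνadd A B hA hB hAB τ hτ
    have h1 : ∑ σ ∈ B.filter (fun σ => σ ≤ τ),
        (if 1 / E ≤ |ν σ / μ σ - ν τ / μ τ| then μ σ else 0) ≤
        ∑ σ ∈ B.filter (fun σ => σ ≤ τ), (|ν σ| / K + μ σ * (|ν τ| / μ τ / K) +
          C * (√(μ σ^2 + ν σ^2) - (μ σ * μ τ + ν σ * ν τ) / √(μ τ^2 + ν τ^2))) := by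
      apply Finset.sum_le_sum
      intro σ hσ
      have hle := (Finset.mem_filter.1 hσ).2
      split_ifs with hc
      · exact l1r_bad _ _ _ _ E K hE hK (hμ0 σ) (l1r_mono hμadd hμ0 hle) hc
      · have := l1r_gain (μ σ) (ν σ) (μ τ) (ν τ)
        have := hμ0 σ
        have := hμ0 τ
        positivity
    refine h1.trans ?_
    rw [Finset.sum_add_distrib, Finset.sum_add_distrib, ← Finset.sum_div, ← Finset.sum_mul,
      ← Finset.mul_sum, Finset.sum_sub_distrib, ← Finset.sum_div, Finset.sum_add_distrib,
      ← Finset.sum_mul, ← Finset.sum_mul, ← hm, ← hn]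
    have e : (μ τ * μ τ + ν τ * ν τ) / √(μ τ^2 + ν τ^2) = √(μ τ^2 + ν τ^2) := by
      rw [← sq, ← sq, Real.div_sqrt]
    rw [e]
    gcongr
    rcases (hμ0 τ).eq_or_lt with h0 | h0
    · rw [← h0, zero_mul]; positivity
    · apply le_of_eq; field_simp
  have h2 := Finset.sum_le_sum key
  rw [Finset.sum_add_distrib, Finset.sum_add_distrib, ← Finset.sum_div, ← Finset.sum_div,
    ← Finset.mul_sum, Finset.sum_sub_distrib,
    l1r_fib (fun σ => |ν σ|) (by simp [hνadd.1]) A B hA hAB,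
    l1r_fib (fun σ => √(μ σ^2 + ν σ^2)) (by simp [hνadd.1, hμadd.1]) A B hA hAB] at h2
  refine le_trans ?_ h2
  simp_rw [Finset.sum_filter]
  rw [Finset.sum_comm]
  apply Finset.sum_le_sum
  intro σ hσ
  have hnn : ∀ τ ∈ A, 0 ≤ (if σ ≤ τ then
      (if 1 / E ≤ |ν σ / μ σ - ν τ / μ τ| then μ σ else 0) else 0) := by
    intro τ _
    have := hμ0 σ
    split_ifs <;> simp [this]
  split_ifs with hc
  · obtain ⟨τ, hτ, hle, hb⟩ := hc
    refine le_trans ?_ (Finset.single_le_sum hnn hτ)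
    rw [if_pos hle, if_pos hb]
  · exact Finset.sum_nonneg hnn

/-- one-dimensional L¹ regularity: there is a partition
    ℬ* ⪰ 𝒜₀ such that for every ℬ with ℬ* ⪯ ℬ ⪯ B̂(ℬ*), the set of elements
    of ℬ whose ν-density differs from that of their ℬ*-cell by at least 1/E
    has μ-measure less than 1/D. -/
theorem one_dimensional_L1_regularity {α : Type*} [BooleanAlgebra α]
    (μ ν : α → ℝ) (hμadd : IsAdditive μ) (hνadd : IsAdditive ν)
    (hμ01 : ∀ σ, 0 ≤ μ σ ∧ μ σ ≤ 1) (hμtop : μ ⊤ = 1)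
    (N : ℝ) (hN : ∀ A : Finset α, IsPartition A → (∑ σ ∈ A, |ν σ|) ≤ N)
    (E Dc : ℝ) (hE : 0 < E) (hDc : 0 < Dc)
    (Bhat : Finset α → Finset α)
    (hBhat : ∀ A : Finset α, IsPartition A →
      IsPartition (Bhat A) ∧ Refines A (Bhat A))
    (A₀ : Finset α) (hA₀ : IsPartition A₀) :
    ∃ Bstar : Finset α, IsPartition Bstar ∧ Refines A₀ Bstar ∧
      ∀ B : Finset α, IsPartition B → Refines Bstar B → Refines B (Bhat Bstar) →
        (∑ σ ∈ B.filter (fun σ =>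
          ∃ τ ∈ Bstar, σ ≤ τ ∧ 1 / E ≤ |ν σ / μ σ - ν τ / μ τ|), μ σ) < 1 / Dc := by
  have hμ0 : ∀ σ, 0 ≤ μ σ := fun σ => (hμ01 σ).1
  have hN0 : 0 ≤ N := by simpa using hN ∅ (by intro σ hσ; simp at hσ)
  obtain ⟨K, hKdef⟩ : ∃ K, K = 4 * Dc * (N + 1) := ⟨_, rfl⟩
  have hK : 0 < K := by rw [hKdef]; positivity
  obtain ⟨C, hC⟩ : ∃ C, C = 2 * (1 + K^2)^2 * E^2 := ⟨_, rfl⟩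
  have hC0 : 0 < C := by rw [hC]; positivity
  let F : Finset α → ℝ := fun A => ∑ σ ∈ A, √(μ σ^2 + ν σ^2)
  let S : Set ℝ := F '' {A | IsPartition A ∧ Refines A₀ A}
  have hne : S.Nonempty := ⟨_, A₀, ⟨hA₀, rfl, fun σ hσ => ⟨σ, hσ, le_rfl⟩⟩, rfl⟩
  have hbdd : BddAbove S := by
    refine ⟨1 + N, ?_⟩
    rintro _ ⟨A, ⟨hA, -⟩, rfl⟩
    calc F A ≤ ∑ σ ∈ A, (μ σ + |ν σ|) := by
          apply Finset.sum_le_sum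
          intro σ _
          have := hμ0 σ
          apply Real.sqrt_le_iff.2 ⟨by positivity, ?_⟩
          have h3 := sq_abs (ν σ)
          have := mul_nonneg this (abs_nonneg (ν σ))
          nlinarith
      _ = μ (A.sup id) + ∑ σ ∈ A, |ν σ| := by
          rw [Finset.sum_add_distrib, l1r_sum hμadd A hA]
      _ ≤ 1 + N := add_le_add (hμ01 _).2 (hN A hA)
  have hc : 0 < 1 / (2 * Dc * C) := by positivity
  obtain ⟨_, ⟨A, ⟨hA, hA0⟩, rfl⟩, hlt⟩ := exists_lt_of_lt_csSup hne (sub_lt_self (sSup S) hc)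
  refine ⟨A, hA, hA0, ?_⟩
  intro B hB hAB _
  have hB0 : Refines A₀ B := by
    refine ⟨hAB.1.trans hA0.1, fun σ hσ => ?_⟩
    obtain ⟨τ, hτ, h1⟩ := hAB.2 σ hσ
    obtain ⟨ρ, hρ, h2⟩ := hA0.2 τ hτ
    exact ⟨ρ, hρ, h1.trans h2⟩
  have hle : F B ≤ sSup S := le_csSup hbdd ⟨B, ⟨hB, hB0⟩, rfl⟩
  have hst := l1r_step μ ν hμadd hνadd hμ0 E K hE hK A B hA hB hAB
  rw [← hC] at hst
  refine lt_of_le_of_lt hst ?_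
  have h1 : (∑ σ ∈ B, |ν σ|) / K ≤ N / K := div_le_div_of_nonneg_right (hN B hB) hK.le
  have h2 : (∑ σ ∈ A, |ν σ|) / K ≤ N / K := div_le_div_of_nonneg_right (hN A hA) hK.le
  have h3 : N / K < 1 / (4 * Dc) := by
    rw [div_lt_div_iff₀ hK (by positivity), hKdef]; nlinarith
  have h4 : C * (F B - F A) < C * (1 / (2 * Dc * C)) :=
    mul_lt_mul_of_pos_left (by linarith) hC0
  have h5 : C * (1 / (2 * Dc * C)) = 1 / (2 * Dc) := by field_simp
  have h6 : 1 / (4 * Dc) + 1 / (4 * Dc) + 1 / (2 * Dc) = 1 / Dc := by field_simp; norm_num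
  have h7 : C * (∑ σ ∈ B, √(μ σ^2 + ν σ^2) - ∑ τ ∈ A, √(μ τ^2 + ν τ^2)) < 1 / (2 * Dc) := by
    rw [← h5]; exact h4
  linarith
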